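/- arXiv:1602.05051 — 3 statements merged into one kernel-verified Lean document; each statement's English description precedes it below -/
import Mathlib

section
/- For all real s, t with 0 ≤ s < 1/2, 0 ≤ t ≤ 1/4 − s/2 and t + s > 0, one has (1 − s)/2 − (1/4)·√(1 − (1 − 2s)(3 − 2s)(t + s)/(1 + t + s)) ≥ (1 − 2s)·C5/(4·(3 + 2s)·C4) − 2·(1 − 2t)(1 − 2s)·√((3 − 2t)(1 + s)(t + s)³)/((3 + 2s)·C4). -/
/-- AM-GM lower bound `12 P / (4 P + 9) ≤ √P`, scaled by `u`. -/
theorem mul_div_le_sqrt_mul_sq {P u : ℝ} (hP : 0 ≤ P) :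
    u * (12 * P) / (4 * P + 9) ≤ Real.sqrt (P * u^2) := by
  apply Real.le_sqrt_of_sq_le
  rw [div_pow, div_le_iff₀ (by positivity)]
  nlinarith [mul_nonneg (mul_nonneg hP (sq_nonneg u)) (sq_nonneg (4 * P - 9))]

/-- The polynomial inequality left after both square roots are replaced by rational bounds;
the certificate is the Bernstein form on the triangle with barycentric coordinates
`2 s`, `4 t`, `1 - 2 s - 4 t`. -/
theorem rational_bound_nonneg (s t : ℝ) (hs : 0 ≤ s) (ht : 0 ≤ t) (htu : t ≤ 1/4 - s/2) :
    0 ≤ ((3 + 2*s) * (16*t^2 - 8*(1 - 2*s)*t + 3*(1 - 2*s)) *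
          ((2 - 4*s) * (1 + (t + s)) + (1 - 2*s) * (3 - 2*s) * (t + s)) -
        2 * (1 - 2*s) * (16*t^3 + 56*t^2*s + 40*t*s^2 + 28*t^2 - 12*s^2 + 12*t*s - 12*t + 9) *
          (1 + (t + s))) * (4 * ((3 - 2*t) * (1 + s) * (t + s)) + 9) +
      16 * (1 - 2*t) * (1 - 2*s) * (t + s) * (1 + (t + s)) *
        (12 * ((3 - 2*t) * (1 + s) * (t + s))) := by
  have key : ∀ a p c : ℝ, 0 ≤ a → 0 ≤ p → 0 ≤ c →
      0 ≤ 135/2 * a^6 * p^3 + 351/2 * a^6 * p^2 * c + 144 * a^6 * p * c^2 + 36 * a^6 * c^3 +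
        609/2 * a^5 * p^4 + 2073/2 * a^5 * p^3 * c + 1296 * a^5 * p^2 * c^2 + 699 * a^5 * p * c^3 +
        135 * a^5 * c^4 + 4627/8 * a^4 * p^5 + 2435 * a^4 * p^4 * c + 32501/8 * a^4 * p^3 * c^2 +
        3340 * a^4 * p^2 * c^3 + 1341 * a^4 * p * c^4 + 207 * a^4 * c^5 + 4715/8 * a^3 * p^6 +
        23639/8 * a^3 * p^5 * c + 49159/8 * a^3 * p^4 * c^2 + 27041/4 * a^3 * p^3 * c^3 +
        32997/8 * a^3 * p^2 * c^4 + 5241/4 * a^3 * p * c^5 + 333/2 * a^3 * c^6 +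
        5411/16 * a^2 * p^7 + 62827/32 * a^2 * p^6 * c + 155877/32 * a^2 * p^5 * c^2 +
        106815/16 * a^2 * p^4 * c^3 + 86911/16 * a^2 * p^3 * c^4 + 2605 * a^2 * p^2 * c^5 +
        675 * a^2 * p * c^6 + 72 * a^2 * c^7 + 825/8 * a * p^8 + 21693/32 * a * p^7 * c +
        31085/16 * a * p^6 * c^2 + 101119/32 * a * p^5 * c^3 + 25379/8 * a * p^4 * c^4 +
        31933/16 * a * p^3 * c^5 + 6075/8 * a * p^2 * c^6 + 315/2 * a * p * c^7 + 27/2 * a * c^8 +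
        13 * p^9 + 1519/16 * p^8 * c + 4897/16 * p^7 * c^2 + 9097/16 * p^6 * c^3 +
        10627/16 * p^5 * c^4 + 995/2 * p^4 * c^5 + 927/4 * p^3 * c^6 + 243/4 * p^2 * c^7 +
        27/4 * p * c^8 := by
    intro a p c ha hp hc
    positivity
  refine (key (2*s) (4*t) (1 - 2*s - 4*t) (by linarith) (by linarith) (by linarith)).trans_eq ?_
  ring

/-- Appendix A: `x_min(s,t) ≥ q2⁻`. -/
theorem stmt_17 (s t C4 C5 : ℝ)
    (hs0 : 0 ≤ s) (hsu : s < 1/2) (ht0 : 0 ≤ t) (htu : t ≤ 1/4 - s/2)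
    (hts : 0 < t + s)
    (hC4 : C4 = 16*t^2 - 8*(1 - 2*s)*t + 3*(1 - 2*s))
    (hC5 : C5 = 16*t^3 + 56*t^2*s + 40*t*s^2 + 28*t^2 - 12*s^2 + 12*t*s - 12*t + 9) :
    (1 - s)/2 - 1/4 * Real.sqrt (1 - (1 - 2*s) * (3 - 2*s) * (t + s) / (1 + t + s)) ≥
      (1 - 2*s) * C5 / (4 * (3 + 2*s) * C4) -
        2 * (1 - 2*t) * (1 - 2*s) *
          Real.sqrt ((3 - 2*t) * (1 + s) * (t + s)^3) / ((3 + 2*s) * C4) := by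
  have hw : 0 < 1 - 2*s := by linarith
  have hC4pos : 0 < C4 := by
    rw [hC4]
    nlinarith [sq_nonneg (4*t - (1 - 2*s))]
  have hu1 : 0 < 1 + t + s := by linarith
  have hP : 0 ≤ (3 - 2*t) * (1 + s) * (t + s) :=
    mul_nonneg (mul_nonneg (by linarith) (by linarith)) hts.le
  set P := (3 - 2*t) * (1 + s) * (t + s) with hPdef
  set z := (1 - 2*s) * (3 - 2*s) * (t + s) / (1 + t + s) with hz
  have hz2 : z ≤ 2 := by
    rw [hz, div_le_iff₀ hu1]
    nlinarith [mul_nonneg hs0 hts.le, mul_nonneg hs0 hw.le,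
      mul_nonneg (mul_nonneg hs0 (show 0 ≤ 2 - s by linarith)) hts.le]
  have hA : Real.sqrt (1 - z) ≤ 1 - z/2 := by
    rw [Real.sqrt_le_iff]
    exact ⟨by linarith, by nlinarith [sq_nonneg z]⟩
  have hB := mul_div_le_sqrt_mul_sq (u := t + s) hP
  rw [show P * (t + s)^2 = (3 - 2*t) * (1 + s) * (t + s)^3 by rw [hPdef]; ring] at hB
  set A := Real.sqrt (1 - z)
  set B := Real.sqrt ((3 - 2*t) * (1 + s) * (t + s)^3)
  have hk : 0 ≤ (1 - 2*t) * (1 - 2*s) := mul_nonneg (by linarith) hw.le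
  have h3 : 0 < 3 + 2*s := by linarith
  have hmain : 0 ≤ (3 + 2*s) * C4 * (2 * (1 - s) - (1 - z/2)) - (1 - 2*s) * C5 +
      8 * ((1 - 2*t) * (1 - 2*s)) * ((t + s) * (12 * P) / (4 * P + 9)) := by
    have h9 : 0 < 4 * P + 9 := by linarith
    have hpoly := rational_bound_nonneg s t hs0 ht0 htu
    rw [← hC4, ← hC5, ← hPdef] at hpoly
    refine (div_nonneg hpoly (by positivity : 0 ≤ 2 * (1 + t + s) * (4 * P + 9))).trans_eq ?_
    rw [hz]
    clear_value P
    field_simp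
    ring
  have hnum : 0 ≤ (3 + 2*s) * C4 * (2 * (1 - s) - A) - (1 - 2*s) * C5 +
      8 * ((1 - 2*t) * (1 - 2*s)) * B := by
    have h1 := mul_le_mul_of_nonneg_left hA (by positivity : 0 ≤ (3 + 2*s) * C4)
    have h2 := mul_le_mul_of_nonneg_left hB hk
    linarith
  rw [ge_iff_le, ← sub_nonneg]
  refine (div_nonneg hnum (by positivity : 0 ≤ 4 * (3 + 2*s) * C4)).trans_eq ?_
  clear_value A B
  field_simp
  ring
end

section
/- For all real s, t with 0 ≤ s < 1/2, 0 ≤ t ≤ 1/4 − s/2 and t + s > 0, one has (3 − 2s)·(5 − 6t − 4·√((1 − t)(1 − 2t)))/(4·(3 − 2t)) ≤ (1 − 2s)·C5/(4·(3 + 2s)·C4) + 2·(1 − 2t)(1 − 2s)·√((3 − 2t)(1 + s)(t + s)³)/((3 + 2s)·C4). -/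
/-- Lower bound for `√((1 - t)(1 - 2t))` by a linear function on `[0, 1/4]`. -/
theorem one_sub_le_sqrt_mul {t : ℝ} (ht0 : 0 ≤ t) (ht : t ≤ 1/4) :
    1 - 8/5*t ≤ Real.sqrt ((1 - t) * (1 - 2*t)) :=
  Real.le_sqrt_of_sq_le (by nlinarith)

/-- Lower bound for the second square root by a polynomial. -/
theorem three_mul_sq_le_sqrt {s t : ℝ} (hs0 : 0 ≤ s) (ht0 : 0 ≤ t) (htu : t ≤ 1/4 - s/2) :
    3 * (t + s)^2 ≤ Real.sqrt ((3 - 2*t) * (1 + s) * (t + s)^3) := by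
  apply Real.le_sqrt_of_sq_le
  have h : 9 * (t + s) ≤ (3 - 2*t) * (1 + s) := by nlinarith
  have h3 : 0 ≤ (t + s)^3 := by positivity
  nlinarith [mul_le_mul_of_nonneg_right h h3]

/-- The polynomial inequality left after both square roots are replaced by their bounds, in the
coordinates `s` and `w = 4t / (1 - 2s)`. -/
theorem polynomial_bound {s w t : ℝ} (hs0 : 0 ≤ s) (hsu : s ≤ 1/2) (hw0 : 0 ≤ w) (hw : w ≤ 1)
    (ht : t = (1 - 2*s)*w/4) :
    (9 - 4*s^2) * (1 + 2/5*t) * (3 - 8*t + 4*t*w) ≤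
      (3 - 2*t) * (16*t^3 + 56*t^2*s + 40*t*s^2 + 28*t^2 - 12*s^2 + 12*t*s - 12*t + 9
        + 24*(1 - 2*t)*(t + s)^2) := by
  have ht0 : 0 ≤ t := by
    have : 0 ≤ 1 - 2*s := by linarith
    rw [ht]
    positivity
  have htw : t ≤ 1/4 - s/2 := by rw [ht]; nlinarith
  have h4 : 4*t*w ≤ 4*t := by nlinarith
  nlinarith [mul_nonneg ht0 hs0, mul_nonneg ht0 hw0, mul_nonneg ht0 ht0,
    mul_nonneg (mul_nonneg ht0 hs0) hs0, mul_nonneg ht0 (sub_nonneg.2 hw),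
    mul_nonneg (mul_nonneg ht0 ht0) hs0, mul_nonneg (mul_nonneg ht0 ht0) ht0]


/-- Appendix B: `x_max(s,t) ≤ q2⁺`. -/
theorem stmt_18 (s t C4 C5 : ℝ)
    (hs0 : 0 ≤ s) (hsu : s < 1/2) (ht0 : 0 ≤ t) (htu : t ≤ 1/4 - s/2)
    (hts : 0 < t + s)
    (hC4 : C4 = 16*t^2 - 8*(1 - 2*s)*t + 3*(1 - 2*s))
    (hC5 : C5 = 16*t^3 + 56*t^2*s + 40*t*s^2 + 28*t^2 - 12*s^2 + 12*t*s - 12*t + 9) :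
    (3 - 2*s) * (5 - 6*t - 4 * Real.sqrt ((1 - t) * (1 - 2*t))) / (4 * (3 - 2*t)) ≤
      (1 - 2*s) * C5 / (4 * (3 + 2*s) * C4) +
        2 * (1 - 2*t) * (1 - 2*s) *
          Real.sqrt ((3 - 2*t) * (1 + s) * (t + s)^3) / ((3 + 2*s) * C4) := by
  have hu : 0 < 1 - 2*s := by linarith
  have ht4 : t ≤ 1/4 := by linarith
  have hR1 := one_sub_le_sqrt_mul ht0 ht4
  have hR2 := three_mul_sq_le_sqrt hs0 ht0 htu
  set R1 := Real.sqrt ((1 - t) * (1 - 2*t))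
  set R2 := Real.sqrt ((3 - 2*t) * (1 + s) * (t + s)^3)
  obtain ⟨w, hw⟩ : ∃ w, w = 4*t/(1 - 2*s) := ⟨_, rfl⟩
  have htw : t = (1 - 2*s)*w/4 := by rw [hw]; field_simp
  have hw0 : 0 ≤ w := by rw [hw]; positivity
  have hw1 : w ≤ 1 := by rw [hw, div_le_one hu]; linarith
  have hP := polynomial_bound hs0 hsu.le hw0 hw1 htw
  rw [← hC5] at hP
  have hC4w : C4 = (1 - 2*s) * (3 - 8*t + 4*t*w) := by
    linear_combination hC4 + 16 * t * htw
  have hC4pos : 0 < C4 := by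
    rw [hC4w]
    exact mul_pos hu (by nlinarith [mul_nonneg ht0 hw0])
  have h3t : 0 < 3 - 2*t := by linarith
  calc (3 - 2*s) * (5 - 6*t - 4*R1) / (4 * (3 - 2*t))
      ≤ (3 - 2*s) * (1 + 2/5*t) / (4 * (3 - 2*t)) := by
        gcongr
        · linarith
        · linarith
    _ ≤ (1 - 2*s) * (C5 + 24*(1 - 2*t)*(t + s)^2) / (4 * (3 + 2*s) * C4) := by
        rw [div_le_div_iff₀ (by positivity) (by positivity), hC4w]
        linear_combination 4 * (1 - 2*s) * hP
    _ ≤ (1 - 2*s) * (C5 + 8*(1 - 2*t)*R2) / (4 * (3 + 2*s) * C4) := by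
        have : 0 ≤ (1 - 2*t) * (R2 - 3*(t + s)^2) :=
          mul_nonneg (by linarith) (by linarith)
        gcongr (1 - 2*s) * ?_ / _
        linarith
    _ = _ := by
        field_simp
        ring
end

section
/- Let b11, b22, b33, b44, b55 be nonnegative real numbers with b11 + b22 + b33 + b44 + b55 = 1/2 and b33 ≥ 26/100, and let b24 be a real number. Then it is not the case that both b24 > (1/2)·√(1 + 2b11 + 4·b22·b44 + 4·b33·b55) and b24 < √((3 − 2b11 − 2b22)(3 − 2b44 − 2b55)) / (2·(2·√((1 − b11)(1 − b55)) + √((1 − 2b11)(1 − 2b55)))). -/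
/-- A chord bound for the concave function `x ↦ √((1 - x) (1 - 2x))` on `[0, 6/25]`. -/
lemma chord_sq_le {x : ℝ} (hx : 0 ≤ x) (hx' : x ≤ 6/25) :
    (1 - 387/250 * x) ^ 2 ≤ (1 - x) * (1 - 2*x) := by
  nlinarith [mul_nonneg hx (sub_nonneg.2 hx')]

/-- An affine function of `(b, d)` that is nonnegative at the vertices of the triangle
`0 ≤ b`, `0 ≤ d`, `b + d ≤ t` is nonnegative on that triangle. -/
lemma affine_nonneg_of_vertices {p q r t b d : ℝ} (hb : 0 ≤ b) (hd : 0 ≤ d) (hbd : b + d ≤ t)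
    (h₀ : 0 ≤ p) (h₁ : 0 ≤ p + q * t) (h₂ : 0 ≤ p + r * t) : 0 ≤ p + q * b + r * d := by
  rcases (add_nonneg hb hd |>.trans hbd).eq_or_lt with ht | ht
  · have hb0 : b = 0 := by linarith
    have hd0 : d = 0 := by linarith
    simpa [hb0, hd0] using h₀
  · refine nonneg_of_mul_nonneg_right (a := t) ?_ ht
    linarith [mul_nonneg (sub_nonneg.2 hbd) h₀, mul_nonneg hb h₁, mul_nonneg hd h₂]

lemma polynomial_bound_s19 {a b d e : ℝ} (ha : 0 ≤ a) (hb : 0 ≤ b) (hd : 0 ≤ d) (he : 0 ≤ e)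
    (hs : a + b + d + e ≤ 6/25) :
    (3 - 2*a - 2*b) * (3 - 2*d - 2*e) ≤
      (1 + 2*a + 4*b*d + 4*(1/2 - a - b - d - e)*e) *
        (4*((1 - a) * (1 - e)) + (1 - 2*a) * (1 - 2*e) +
          4*((1 - 387/250*a) * (1 - 387/250*e))) := by
  have hae := mul_nonneg ha he
  have hbd := mul_nonneg hb hd
  have ht : 0 ≤ 6/25 - a - e := by linarith
  have hat := mul_nonneg ha ht
  have het := mul_nonneg he ht
  set Q := 4*((1 - a) * (1 - e)) + (1 - 2*a) * (1 - 2*e) +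
          4*((1 - 387/250*a) * (1 - 387/250*e)) with hQ
  have hQ1 : 1 ≤ Q := by rw [hQ]; nlinarith
  have key := affine_nonneg_of_vertices (t := 6/25 - a - e)
    (p := (1 + 2*a + 4*(1/2 - a - e)*e) * Q - 9 + 6*(a + e) - 4*a*e)
    (q := 6 - 4*e - 4*e*Q) (r := 6 - 4*a - 4*e*Q) hb hd (by linarith)
    (by rw [hQ]; nlinarith)
    (by rw [hQ]; nlinarith)
    (by rw [hQ]; nlinarith)
  nlinarith [mul_nonneg hbd (sub_nonneg.2 hQ1)]

/-- Appendix C: if `b33 ≥ 26/100` then the lower and upper bounds on `b24`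
cannot both hold. -/
theorem stmt_19 (b11 b22 b33 b44 b55 b24 : ℝ)
    (h11 : 0 ≤ b11) (h22 : 0 ≤ b22) (h33 : 0 ≤ b33) (h44 : 0 ≤ b44) (h55 : 0 ≤ b55)
    (hsum : b11 + b22 + b33 + b44 + b55 = 1/2)
    (h33lb : b33 ≥ 26/100) :
    ¬ (b24 > 1/2 * Real.sqrt (1 + 2*b11 + 4*b22*b44 + 4*b33*b55) ∧
       b24 < Real.sqrt ((3 - 2*b11 - 2*b22) * (3 - 2*b44 - 2*b55)) /
         (2 * (2 * Real.sqrt ((1 - b11) * (1 - b55)) +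
           Real.sqrt ((1 - 2*b11) * (1 - 2*b55))))) := by
  rintro ⟨hlow, hup⟩
  refine (hlow.trans hup).not_ge ?_
  have ha1 : 0 < 1 - 2*b11 := by linarith
  have he1 : 0 < 1 - 2*b55 := by linarith
  have hu : 0 < (1 - b11) * (1 - b55) := mul_pos (by linarith) (by linarith)
  have hv : 0 < (1 - 2*b11) * (1 - 2*b55) := mul_pos ha1 he1
  have hchord : (1 - 387/250*b11) * (1 - 387/250*b55) ≤
      √((1 - b11) * (1 - b55)) * √((1 - 2*b11) * (1 - 2*b55)) := by
    rw [← Real.sqrt_mul hu.le]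
    refine Real.le_sqrt_of_sq_le ?_
    calc ((1 - 387/250*b11) * (1 - 387/250*b55)) ^ 2
        = (1 - 387/250*b11) ^ 2 * (1 - 387/250*b55) ^ 2 := mul_pow _ _ _
      _ ≤ ((1 - b11) * (1 - 2*b11)) * ((1 - b55) * (1 - 2*b55)) :=
        mul_le_mul (chord_sq_le h11 (by linarith)) (chord_sq_le h55 (by linarith))
          (sq_nonneg _) (mul_nonneg (by linarith) ha1.le)
      _ = _ := by ring
  have hpoly := polynomial_bound_s19 h11 h22 h44 h55 (by linarith)
  rw [show 1/2 - b11 - b22 - b44 - b55 = b33 by linarith] at hpoly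
  have hw : 0 ≤ 1 + 2*b11 + 4*b22*b44 + 4*b33*b55 := by positivity
  have hP : 0 < 2 * √((1 - b11) * (1 - b55)) + √((1 - 2*b11) * (1 - 2*b55)) := by positivity
  have hPsq : 4*((1 - b11) * (1 - b55)) + (1 - 2*b11) * (1 - 2*b55) +
      4*((1 - 387/250*b11) * (1 - 387/250*b55)) ≤
      (2 * √((1 - b11) * (1 - b55)) + √((1 - 2*b11) * (1 - 2*b55))) ^ 2 := by
    linarith [Real.sq_sqrt hu.le, Real.sq_sqrt hv.le]
  have hsqrt : √((3 - 2*b11 - 2*b22) * (3 - 2*b44 - 2*b55)) ≤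
      √(1 + 2*b11 + 4*b22*b44 + 4*b33*b55) *
        (2 * √((1 - b11) * (1 - b55)) + √((1 - 2*b11) * (1 - 2*b55))) := by
    refine Real.sqrt_le_iff.2 ⟨by positivity, ?_⟩
    rw [mul_pow, Real.sq_sqrt hw]
    exact hpoly.trans (mul_le_mul_of_nonneg_left hPsq hw)
  rw [div_le_iff₀ (by positivity)]
  linarith
end
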